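/- Every complex structure J on su(2) ⊕ su(2) is equivalent under some element of SO(3) × SO(3) to J(ξ,η) for some ξ ∈ ℝ and η ∈ ℝ, η ≠ 0, where J(ξ,η) is the 6×6 matrix with rows (0,1,0,0,0,0), (−1,0,0,0,0,0), (0,0,ξ,0,0,η), (0,0,0,0,1,0), (0,0,0,−1,0,0), (0,0,−(1+ξ²)/η,0,0,−ξ). -/

import Mathlib

/-- `R` is a special orthogonal 3×3 matrix. -/
def so3 (R : Matrix (Fin 3) (Fin 3) ℝ) : Prop := R * R.transpose = 1 ∧ R.det = 1

/-- The Lie bracket of su(2) ⊕ su(2) in the basis (J₁⁽¹⁾,J₂⁽¹⁾,J₃⁽¹⁾,J₁⁽²⁾,J₂⁽²⁾,J₃⁽²⁾):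
the cross product on each group of three coordinates. -/
def bra6 (x y : Fin 6 → ℝ) : Fin 6 → ℝ :=
  ![x 1 * y 2 - x 2 * y 1, x 2 * y 0 - x 0 * y 2, x 0 * y 1 - x 1 * y 0,
    x 4 * y 5 - x 5 * y 4, x 5 * y 3 - x 3 * y 5, x 3 * y 4 - x 4 * y 3]

/-- `J` (as a 6×6 matrix) has zero torsion on su(2) ⊕ su(2). -/
def torsion6 (J : Matrix (Fin 6) (Fin 6) ℝ) : Prop :=
  ∀ X Y : Fin 6 → ℝ,
    bra6 (J.mulVec X) (J.mulVec Y) - bra6 X Y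
      - J.mulVec (bra6 (J.mulVec X) Y) - J.mulVec (bra6 X (J.mulVec Y)) = 0

/-- `J` is a complex structure on su(2) ⊕ su(2). -/
def isCx6 (J : Matrix (Fin 6) (Fin 6) ℝ) : Prop := J * J = -1 ∧ torsion6 J

/-- The block-diagonal 6×6 matrix diag(A, B), for A, B 3×3. -/
def diag33 (A B : Matrix (Fin 3) (Fin 3) ℝ) : Matrix (Fin 6) (Fin 6) ℝ :=
  !![A 0 0, A 0 1, A 0 2, 0, 0, 0;
     A 1 0, A 1 1, A 1 2, 0, 0, 0;
     A 2 0, A 2 1, A 2 2, 0, 0, 0;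
     0, 0, 0, B 0 0, B 0 1, B 0 2;
     0, 0, 0, B 1 0, B 1 1, B 1 2;
     0, 0, 0, B 2 0, B 2 1, B 2 2]

/-- The normal form J(ξ,η). -/
noncomputable def Jxe (ξ η : ℝ) : Matrix (Fin 6) (Fin 6) ℝ :=
  !![0, 1, 0, 0, 0, 0;
     -1, 0, 0, 0, 0, 0;
     0, 0, ξ, 0, 0, η;
     0, 0, 0, 0, 1, 0;
     0, 0, 0, -1, 0, 0;
     0, 0, -(1 + ξ ^ 2) / η, 0, 0, -ξ]

/-- The condition on a 3×3 block `A` expressing that torsion vanishes in that block. -/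
def IsTorsionBlock (A : Matrix (Fin 3) (Fin 3) ℝ) : Prop :=
  A.adjugate.transpose - 1 = A * (A.trace • (1 : Matrix (Fin 3) (Fin 3) ℝ) - A.transpose)

theorem adjugate_fin_three_eq_sq (A : Matrix (Fin 3) (Fin 3) ℝ) :
    A.adjugate = A * A - A.trace • A + A.adjugate.trace • 1 := by
  ext i j
  fin_cases i <;> fin_cases j <;>
    simp [Matrix.adjugate_fin_three, Matrix.mul_apply, Matrix.trace, Fin.sum_univ_three] <;> ring

theorem IsTorsionBlock.mul_symm_part {A : Matrix (Fin 3) (Fin 3) ℝ} (h : IsTorsionBlock A) :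
    (A - A.trace • 1) * (A + A.transpose) = (1 - A.adjugate.trace) • 1 := by
  have h' := congrArg Matrix.transpose h
  rw [Matrix.transpose_sub, Matrix.transpose_transpose, adjugate_fin_three_eq_sq] at h'
  simp only [Matrix.transpose_mul, Matrix.transpose_sub, Matrix.transpose_smul,
    Matrix.transpose_one, Matrix.transpose_transpose, sub_mul, smul_mul_assoc, one_mul] at h'
  simp only [sub_mul, mul_add, smul_mul_assoc, one_mul, sub_smul, one_smul]
  rw [sub_eq_iff_eq_add] at h'
  linear_combination (norm := module) h'

theorem IsTorsionBlock.trace_adjugate {A : Matrix (Fin 3) (Fin 3) ℝ} (h : IsTorsionBlock A) :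
    A.adjugate.trace = 1 := by
  by_contra hs
  have hs' : 1 - A.adjugate.trace ≠ 0 := sub_ne_zero.mpr (Ne.symm hs)
  have h₁ := h.mul_symm_part
  have h₂ : (A + A.transpose) * (A - A.trace • 1) = (1 - A.adjugate.trace) • 1 := by
    have : ((1 - A.adjugate.trace)⁻¹ • (A - A.trace • 1)) * (A + A.transpose) = 1 := by
      rw [smul_mul_assoc, h₁, smul_smul, inv_mul_cancel₀ hs', one_smul]
    rw [mul_eq_one_comm, mul_smul_comm] at this
    exact (inv_smul_eq_iff₀ hs').mp this
  have h₃ : (A + A.transpose) * (A.transpose - A.trace • 1) = (1 - A.adjugate.trace) • 1 := by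
    simpa [add_comm] using congrArg Matrix.transpose h₁
  have hsymm : A.transpose = A := by
    have h₄ : (A + A.transpose) * (A.transpose - A) = 0 := by
      rw [← sub_sub_sub_cancel_right _ _ (A.trace • 1), mul_sub, h₃, h₂, sub_self]
    have h₅ := congrArg (fun M => (A - A.trace • 1) * M) h₄
    simp only [← mul_assoc, h₁, mul_zero, smul_mul_assoc, one_mul] at h₅
    exact sub_eq_zero.mp ((smul_eq_zero.mp h₅).resolve_left hs')
  rw [hsymm] at h₁
  have htr := congrArg Matrix.trace h₁
  have hsq : (A * A).trace = A.trace ^ 2 - 2 * A.adjugate.trace := by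
    simp only [Matrix.adjugate_fin_three, Matrix.trace, Matrix.mul_apply, Fin.sum_univ_three,
      Matrix.diag]
    simp
    ring
  simp only [sub_mul, mul_add, smul_mul_assoc, one_mul, Matrix.trace_add, Matrix.trace_sub,
    Matrix.trace_smul, Matrix.trace_one, Fintype.card_fin, smul_eq_mul, hsq] at htr
  have hs3 : A.adjugate.trace = -3 := by
    push_cast at htr
    linarith
  have hA2 : A * A = A.trace • A + (2 : ℝ) • 1 := by
    have : (2 : ℝ) • (A * A - A.trace • A - (2 : ℝ) • 1) = 0 := by
      rw [hs3] at h₁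
      simp only [sub_mul, mul_add, smul_mul_assoc, one_mul] at h₁
      linear_combination (norm := module) h₁
    have := (smul_eq_zero.mp this).resolve_left two_ne_zero
    linear_combination (norm := module) this
  have hadj : A.adjugate = (-1 : ℝ) • 1 := by
    rw [adjugate_fin_three_eq_sq, hA2, hs3]
    module
  have hdet : -A = A.det • 1 := by
    rw [← Matrix.mul_adjugate, hadj]; simp
  have hA : A = (-A.det) • 1 := by
    rw [neg_smul, ← hdet, neg_neg]
  have h00 := congrFun (congrFun hA2 0) 0
  rw [hA, Matrix.trace_smul] at h00
  simp at h00
  nlinarith [sq_nonneg A.det]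

theorem eq_zero_of_sum_sq_eq_zero {u v w x y z : ℝ}
    (h : u ^ 2 + v ^ 2 + w ^ 2 + 2 * (x ^ 2 + y ^ 2 + z ^ 2) = 0) :
    u = 0 ∧ v = 0 ∧ w = 0 ∧ x = 0 ∧ y = 0 ∧ z = 0 := by
  refine ⟨?_, ?_, ?_, ?_, ?_, ?_⟩ <;> nlinarith

theorem IsTorsionBlock.exists_axis {A : Matrix (Fin 3) (Fin 3) ℝ} (h : IsTorsionBlock A) :
    ∃ a b c t : ℝ, a ^ 2 + b ^ 2 + c ^ 2 = 1 ∧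
      A = !![t * a ^ 2, t * a * b + c, t * a * c - b;
             t * a * b - c, t * b ^ 2, t * b * c + a;
             t * a * c + b, t * b * c - a, t * c ^ 2] := by
  have hs := h.trace_adjugate
  have hE := h.mul_symm_part
  rw [hs, sub_self, zero_smul] at hE
  have e := fun i j => congrFun (congrFun hE i) j
  obtain ⟨p, q, r, x, y, z, a, b, c, rfl⟩ : ∃ p q r x y z a b c : ℝ,
      A = !![p, z + c, y - b; z - c, q, x + a; y + b, x - a, r] :=
    ⟨A 0 0, A 1 1, A 2 2, (A 1 2 + A 2 1) / 2, (A 0 2 + A 2 0) / 2, (A 0 1 + A 1 0) / 2,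
      (A 1 2 - A 2 1) / 2, (A 2 0 - A 0 2) / 2, (A 0 1 - A 1 0) / 2, by
      ext i j
      fin_cases i <;> fin_cases j <;> simp <;> ring⟩
  simp [Matrix.adjugate_fin_three, Matrix.trace, Fin.sum_univ_three] at hs
  have e00 := e 0 0
  have e01 := e 0 1
  have e02 := e 0 2
  have e10 := e 1 0
  have e11 := e 1 1
  have e12 := e 1 2
  have e20 := e 2 0
  have e21 := e 2 1
  have e22 := e 2 2
  simp [Matrix.mul_apply, Matrix.trace, Fin.sum_univ_three] at e00 e01 e02 e10 e11 e12 e20 e21 e22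
  have hP : p ^ 2 + q ^ 2 + r ^ 2 + 2 * (x ^ 2 + y ^ 2 + z ^ 2) = (p + q + r) ^ 2 := by
    linear_combination (e00 + e11 + e22) / 2
  have hk : a ^ 2 + b ^ 2 + c ^ 2 = 1 := by
    linear_combination hs + hP / 2
  have hkPk : p * a ^ 2 + q * b ^ 2 + r * c ^ 2 + 2 * (x * b * c + y * a * c + z * a * b)
      = p + q + r := by
    linear_combination (p + q + r) * hk +
      (c * e10 - c * e01 + b * e02 - b * e20 + a * e21 - a * e12) / 2
  set t := p + q + r with ht
  have hQ : (p - t * a ^ 2) ^ 2 + (q - t * b ^ 2) ^ 2 + (r - t * c ^ 2) ^ 2 +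
      2 * ((x - t * b * c) ^ 2 + (y - t * a * c) ^ 2 + (z - t * a * b) ^ 2) = 0 := by
    linear_combination hP - 2 * t * hkPk + t ^ 2 * (a ^ 2 + b ^ 2 + c ^ 2 + 1) * hk
  obtain ⟨hp, hq, hr, hx, hy, hz⟩ := eq_zero_of_sum_sq_eq_zero hQ
  rw [sub_eq_zero] at hp hq hr hx hy hz
  exact ⟨a, b, c, t, hk, by rw [← hp, ← hq, ← hr, ← hx, ← hy, ← hz]⟩

theorem exists_so3_third_column {a b c : ℝ} (h : a ^ 2 + b ^ 2 + c ^ 2 = 1) :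
    ∃ R : Matrix (Fin 3) (Fin 3) ℝ, so3 R ∧ R 0 2 = a ∧ R 1 2 = b ∧ R 2 2 = c := by
  by_cases hc : 1 + c = 0
  · have hc' : c = -1 := by linarith
    subst hc'
    have ha : a = 0 := by nlinarith
    have hb : b = 0 := by nlinarith
    subst ha hb
    refine ⟨!![1, 0, 0; 0, -1, 0; 0, 0, -1], ⟨?_, ?_⟩, by simp, by simp, by simp⟩
    · ext i j
      fin_cases i <;> fin_cases j <;> simp [Matrix.mul_apply, Fin.sum_univ_three]
    · simp [Matrix.det_fin_three]
  · obtain ⟨d, hd⟩ : ∃ d, d * (1 + c) = 1 := ⟨(1 + c)⁻¹, inv_mul_cancel₀ hc⟩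
    have hab : d * (a ^ 2 + b ^ 2) = 1 - c := by
      linear_combination d * h + (1 - c) * hd
    refine ⟨!![1 - d * a ^ 2, -d * a * b, a; -d * a * b, 1 - d * b ^ 2, b; -a, -b, c],
      ⟨?_, ?_⟩, by simp, by simp, by simp⟩
    · ext i j
      fin_cases i <;> fin_cases j <;> simp [Matrix.mul_apply, Fin.sum_univ_three]
      · linear_combination d * a ^ 2 * hab - a ^ 2 * hd
      · linear_combination d * a * b * hab - a * b * hd
      · linear_combination a * hab
      · linear_combination d * a * b * hab - a * b * hd
      · linear_combination d * b ^ 2 * hab - b ^ 2 * hd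
      · linear_combination b * hab
      · linear_combination a * hab
      · linear_combination b * hab
      · linear_combination h
    · simp [Matrix.det_fin_three]
      linear_combination h - c * hab

theorem so3.transpose_mul {R : Matrix (Fin 3) (Fin 3) ℝ} (hR : so3 R) : R.transpose * R = 1 :=
  mul_eq_one_comm.mp hR.1

theorem so3.transpose {R : Matrix (Fin 3) (Fin 3) ℝ} (hR : so3 R) : so3 R.transpose :=
  ⟨by rw [Matrix.transpose_transpose, hR.transpose_mul], by rw [Matrix.det_transpose, hR.2]⟩

theorem so3.adjugate_eq {R : Matrix (Fin 3) (Fin 3) ℝ} (hR : so3 R) :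
    R.adjugate = R.transpose := by
  have h := R.adjugate_mul
  rw [hR.2, one_smul] at h
  rw [← mul_one R.adjugate, ← hR.1, ← mul_assoc, h, one_mul]

/-- The normal form of a diagonal block of a complex structure. -/
def normalBlock (t : ℝ) : Matrix (Fin 3) (Fin 3) ℝ := !![0, 1, 0; -1, 0, 0; 0, 0, t]

theorem IsTorsionBlock.exists_rotation {A : Matrix (Fin 3) (Fin 3) ℝ} (h : IsTorsionBlock A) :
    ∃ (R : Matrix (Fin 3) (Fin 3) ℝ) (t : ℝ),
      so3 R ∧ R.transpose * A * R = normalBlock t := by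
  obtain ⟨a, b, c, t, hk, rfl⟩ := h.exists_axis
  obtain ⟨R, hR, rfl, rfl, rfl⟩ := exists_so3_third_column hk
  refine ⟨R, t, hR, ?_⟩
  have hadj := fun i j => congrFun (congrFun hR.adjugate_eq i) j
  have h20 := hadj 2 0
  have h21 := hadj 2 1
  have h22 := hadj 2 2
  simp [Matrix.adjugate_fin_three] at h20 h21 h22
  have key : R * normalBlock t * R.transpose =
      !![t * R 0 2 ^ 2, t * R 0 2 * R 1 2 + R 2 2, t * R 0 2 * R 2 2 - R 1 2;
         t * R 0 2 * R 1 2 - R 2 2, t * R 1 2 ^ 2, t * R 1 2 * R 2 2 + R 0 2;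
         t * R 0 2 * R 2 2 + R 1 2, t * R 1 2 * R 2 2 - R 0 2, t * R 2 2 ^ 2] := by
    ext i j
    fin_cases i <;> fin_cases j <;>
      simp [normalBlock, Matrix.mul_apply, Fin.sum_univ_three] <;> linarith
  rw [← key]
  calc R.transpose * (R * normalBlock t * R.transpose) * R
      = (R.transpose * R) * normalBlock t * (R.transpose * R) := by simp only [mul_assoc]
    _ = normalBlock t := by rw [hR.transpose_mul, one_mul, mul_one]

theorem diag33_mul (A B C D : Matrix (Fin 3) (Fin 3) ℝ) :
    diag33 A B * diag33 C D = diag33 (A * C) (B * D) := by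
  ext i j
  fin_cases i <;> fin_cases j <;>
    simp [diag33, Matrix.mul_apply, Fin.sum_univ_six, Fin.sum_univ_three]

theorem diag33_one : diag33 1 1 = 1 := by
  ext i j
  fin_cases i <;> fin_cases j <;> simp [diag33]

theorem bra6_diag33_mulVec {R S : Matrix (Fin 3) (Fin 3) ℝ} (hR : so3 R) (hS : so3 S)
    (x y : Fin 6 → ℝ) :
    bra6 ((diag33 R S).mulVec x) ((diag33 R S).mulVec y) = (diag33 R S).mulVec (bra6 x y) := by
  have key : ∀ {T : Matrix (Fin 3) (Fin 3) ℝ}, so3 T → ∀ i j, T.adjugate j i = T i j :=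
    fun hT i j => congrFun (congrFun hT.adjugate_eq j) i
  have cross : ∀ {T : Matrix (Fin 3) (Fin 3) ℝ}, so3 T → ∀ (k : Fin 3) (a b c : ℝ),
      T k 0 * a + T k 1 * b + T k 2 * c =
        T.adjugate 0 k * a + T.adjugate 1 k * b + T.adjugate 2 k * c :=
    fun hT k a b c => by rw [key hT, key hT, key hT]
  ext i
  fin_cases i <;> simp [bra6, diag33, Matrix.mulVec, dotProduct, Fin.sum_univ_six]
  · rw [cross hR 0]; simp [Matrix.adjugate_fin_three]; ring
  · rw [cross hR 1]; simp [Matrix.adjugate_fin_three]; ring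
  · rw [cross hR 2]; simp [Matrix.adjugate_fin_three]; ring
  · rw [cross hS 0]; simp [Matrix.adjugate_fin_three]; ring
  · rw [cross hS 1]; simp [Matrix.adjugate_fin_three]; ring
  · rw [cross hS 2]; simp [Matrix.adjugate_fin_three]; ring

theorem isCx6.conj {J : Matrix (Fin 6) (Fin 6) ℝ} (hJ : isCx6 J)
    {R S : Matrix (Fin 3) (Fin 3) ℝ} (hR : so3 R) (hS : so3 S) :
    isCx6 (diag33 R.transpose S.transpose * J * diag33 R S) := by
  have hQP : diag33 R.transpose S.transpose * diag33 R S = 1 := by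
    rw [diag33_mul, hR.transpose_mul, hS.transpose_mul, diag33_one]
  have hb := bra6_diag33_mulVec hR.transpose hS.transpose
  generalize diag33 R.transpose S.transpose = Q at *
  generalize diag33 R S = P at *
  have hPQ : P * Q = 1 := mul_eq_one_comm.mp hQP
  refine ⟨?_, fun X Y => ?_⟩
  · calc Q * J * P * (Q * J * P) = Q * J * (P * Q) * J * P := by simp only [mul_assoc]
      _ = Q * (J * J) * P := by rw [hPQ]; simp only [mul_assoc, one_mul]
      _ = -1 := by rw [hJ.1]; simp [hQP]
  · have hmul : ∀ v, (Q * J * P).mulVec v = Q.mulVec (J.mulVec (P.mulVec v)) := fun v => by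
      simp only [Matrix.mulVec_mulVec, mul_assoc]
    have hQPv : ∀ v, Q.mulVec (P.mulVec v) = v := fun v => by
      rw [Matrix.mulVec_mulVec, hQP, Matrix.one_mulVec]
    have hPQv : ∀ v, P.mulVec (Q.mulVec v) = v := fun v => by
      rw [Matrix.mulVec_mulVec, hPQ, Matrix.one_mulVec]
    have hT := congrArg Q.mulVec (hJ.2 (P.mulVec X) (P.mulVec Y))
    rw [← hQPv X, ← hQPv Y]
    simp only [hmul, hPQv, hb]
    simpa only [Matrix.mulVec_sub, Matrix.mulVec_zero] using hT

/-- The upper left 3×3 block. -/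
def upperBlock (J : Matrix (Fin 6) (Fin 6) ℝ) : Matrix (Fin 3) (Fin 3) ℝ :=
  !![J 0 0, J 0 1, J 0 2; J 1 0, J 1 1, J 1 2; J 2 0, J 2 1, J 2 2]

/-- The lower right 3×3 block. -/
def lowerBlock (J : Matrix (Fin 6) (Fin 6) ℝ) : Matrix (Fin 3) (Fin 3) ℝ :=
  !![J 3 3, J 3 4, J 3 5; J 4 3, J 4 4, J 4 5; J 5 3, J 5 4, J 5 5]

theorem upperBlock_diag33_mul (J : Matrix (Fin 6) (Fin 6) ℝ) (A B : Matrix (Fin 3) (Fin 3) ℝ) :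
    upperBlock (diag33 A B * J) = A * upperBlock J := by
  ext i j
  fin_cases i <;> fin_cases j <;>
    simp [upperBlock, diag33, Matrix.mul_apply, Fin.sum_univ_six, Fin.sum_univ_three]

theorem upperBlock_mul_diag33 (J : Matrix (Fin 6) (Fin 6) ℝ) (A B : Matrix (Fin 3) (Fin 3) ℝ) :
    upperBlock (J * diag33 A B) = upperBlock J * A := by
  ext i j
  fin_cases i <;> fin_cases j <;>
    simp [upperBlock, diag33, Matrix.mul_apply, Fin.sum_univ_six, Fin.sum_univ_three]

theorem lowerBlock_diag33_mul (J : Matrix (Fin 6) (Fin 6) ℝ) (A B : Matrix (Fin 3) (Fin 3) ℝ) :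
    lowerBlock (diag33 A B * J) = B * lowerBlock J := by
  ext i j
  fin_cases i <;> fin_cases j <;>
    simp [lowerBlock, diag33, Matrix.mul_apply, Fin.sum_univ_six, Fin.sum_univ_three]

theorem lowerBlock_mul_diag33 (J : Matrix (Fin 6) (Fin 6) ℝ) (A B : Matrix (Fin 3) (Fin 3) ℝ) :
    lowerBlock (J * diag33 A B) = lowerBlock J * B := by
  ext i j
  fin_cases i <;> fin_cases j <;>
    simp [lowerBlock, diag33, Matrix.mul_apply, Fin.sum_univ_six, Fin.sum_univ_three]

theorem torsion6.col {J : Matrix (Fin 6) (Fin 6) ℝ} (h : torsion6 J) (i j k : Fin 6) :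
    bra6 (J.col i) (J.col j) k - bra6 (Pi.single i 1) (Pi.single j 1) k
      - J.mulVec (bra6 (J.col i) (Pi.single j 1)) k
      - J.mulVec (bra6 (Pi.single i 1) (J.col j)) k = 0 := by
  simpa only [Matrix.mulVec_single_one, Pi.sub_apply, Pi.zero_apply] using
    congrFun (h (Pi.single i 1) (Pi.single j 1)) k

theorem torsion6.upperBlock {J : Matrix (Fin 6) (Fin 6) ℝ} (h : torsion6 J) :
    IsTorsionBlock (upperBlock J) := by
  ext k l
  have h0 := h.col 1 2
  have h1 := h.col 2 0
  have h2 := h.col 0 1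
  fin_cases k <;> [have h0 := h0 0; have h0 := h0 1; have h0 := h0 2] <;>
  [have h1 := h1 0; have h1 := h1 1; have h1 := h1 2] <;>
  [have h2 := h2 0; have h2 := h2 1; have h2 := h2 2] <;>
  simp [bra6, Matrix.mulVec, dotProduct, Fin.sum_univ_six] at h0 h1 h2 <;>
  fin_cases l <;>
    simp [_root_.upperBlock, Matrix.adjugate_fin_three, Matrix.mul_apply, Matrix.trace,
      Fin.sum_univ_three] <;>
  first
  | linear_combination h0
  | linear_combination h1
  | linear_combination h2

theorem torsion6.lowerBlock {J : Matrix (Fin 6) (Fin 6) ℝ} (h : torsion6 J) :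
    IsTorsionBlock (lowerBlock J) := by
  ext k l
  have h0 := h.col 4 5
  have h1 := h.col 5 3
  have h2 := h.col 3 4
  fin_cases k <;> [have h0 := h0 3; have h0 := h0 4; have h0 := h0 5] <;>
  [have h1 := h1 3; have h1 := h1 4; have h1 := h1 5] <;>
  [have h2 := h2 3; have h2 := h2 4; have h2 := h2 5] <;>
  simp [bra6, Matrix.mulVec, dotProduct, Fin.sum_univ_six] at h0 h1 h2 <;>
  fin_cases l <;>
    simp [_root_.lowerBlock, Matrix.adjugate_fin_three, Matrix.mul_apply, Matrix.trace,
      Fin.sum_univ_three] <;>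
  first
  | linear_combination h0
  | linear_combination h1
  | linear_combination h2

theorem eq_zero_of_add_mul_eq_zero {s p q : ℝ} (h₁ : p + s * q = 0) (h₂ : -q + s * p = 0) :
    p = 0 ∧ q = 0 := by
  have hq : q * (1 + s ^ 2) = 0 := by linear_combination s * h₁ - h₂
  have hq' : q = 0 := (mul_eq_zero.mp hq).resolve_right (by positivity)
  subst hq'
  exact ⟨by linarith, rfl⟩

theorem eq_zero_of_det_eq_zero {p q r s : ℝ} (h₁ : p * s - q * r = 0) (h₂ : q - r = 0)
    (h₃ : s + p = 0) : p = 0 ∧ q = 0 ∧ r = 0 ∧ s = 0 := by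
  obtain rfl : q = r := by linarith
  obtain rfl : s = -p := by linarith
  have hp : p = 0 := by nlinarith
  have hq : q = 0 := by nlinarith
  simp [hp, hq]

theorem isCx6.eq_Jxe {J : Matrix (Fin 6) (Fin 6) ℝ} (hJ : isCx6 J) {t u : ℝ}
    (hA : upperBlock J = normalBlock t) (hD : lowerBlock J = normalBlock u) :
    ∃ η : ℝ, η ≠ 0 ∧ J = Jxe t η := by
  have hB := hJ.2.col 3 4 2
  have hC := hJ.2.col 0 1 5
  have hsq := fun i j => congrFun (congrFun hJ.1 i) j
  simp [upperBlock, lowerBlock, normalBlock] at hA hD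
  obtain ⟨⟨a00, a01, a02⟩, ⟨a10, a11, a12⟩, a20, a21, a22⟩ := hA
  obtain ⟨⟨d00, d01, d02⟩, ⟨d10, d11, d12⟩, d20, d21, d22⟩ := hD
  simp [bra6, Matrix.mulVec, dotProduct, Fin.sum_univ_six, *] at hB hC
  simp only [Matrix.mul_apply, Fin.sum_univ_six] at hsq
  have b00 := hsq 0 3
  have b01 := hsq 0 4
  have b02 := hsq 0 5
  have b12 := hsq 1 5
  have b20 := hsq 2 3
  have b21 := hsq 2 4
  have b22 := hsq 2 5
  have c00 := hsq 3 0
  have c01 := hsq 3 1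
  have c02 := hsq 3 2
  have c12 := hsq 4 2
  have c20 := hsq 5 0
  have c21 := hsq 5 1
  have hη := hsq 2 2
  clear hsq
  simp [*] at b00 b01 b02 b12 b20 b21 b22 c00 c01 c02 c12 c20 c21 hη
  obtain ⟨e03, e13, e04, e14⟩ := eq_zero_of_det_eq_zero hB (by linarith) (by linarith)
  obtain ⟨e30, e40, e31, e41⟩ := eq_zero_of_det_eq_zero hC (by linarith) (by linarith)
  obtain ⟨e15, e05⟩ := eq_zero_of_add_mul_eq_zero (s := u) (p := J 1 5) (q := J 0 5)
    (by linarith) (by linarith)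
  obtain ⟨e42, e32⟩ := eq_zero_of_add_mul_eq_zero (s := t) (p := J 4 2) (q := J 3 2)
    (by linarith) (by linarith)
  obtain ⟨e23, e24⟩ := eq_zero_of_add_mul_eq_zero (s := t) (p := J 2 3) (q := J 2 4)
    (by linarith) (by linarith)
  obtain ⟨e50, e51⟩ := eq_zero_of_add_mul_eq_zero (s := u) (p := J 5 0) (q := J 5 1)
    (by linarith) (by linarith)
  simp only [e23, e24] at hη
  have hne : J 2 5 ≠ 0 := by
    intro h0
    rw [h0] at hη
    nlinarith
  have hu : u = -t := by
    have : J 2 5 * (u + t) = 0 := by linarith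
    linarith [(mul_eq_zero.mp this).resolve_left hne]
  have e52 : J 5 2 = -(1 + t ^ 2) / J 2 5 := by
    rw [eq_div_iff hne]
    linarith
  refine ⟨J 2 5, hne, ?_⟩
  ext i j
  fin_cases i <;> fin_cases j <;> simp [Jxe, *]

/-- Every complex structure on su(2) ⊕ su(2) is equivalent under some element of
SO(3) × SO(3) to J(ξ,η) for some ξ ∈ ℝ, η ≠ 0. -/
theorem stmt10 (J : Matrix (Fin 6) (Fin 6) ℝ) (hJ : isCx6 J) :
    ∃ (ξ η : ℝ) (Φ₁ Φ₂ : Matrix (Fin 3) (Fin 3) ℝ), η ≠ 0 ∧ so3 Φ₁ ∧ so3 Φ₂ ∧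
      J = diag33 Φ₁ Φ₂ * Jxe ξ η * (diag33 Φ₁ Φ₂)⁻¹ := by
  obtain ⟨R, t, hR, hRt⟩ := hJ.2.upperBlock.exists_rotation
  obtain ⟨S, u, hS, hSu⟩ := hJ.2.lowerBlock.exists_rotation
  obtain ⟨η, hη, h⟩ := (hJ.conj hR hS).eq_Jxe
    (by rw [upperBlock_mul_diag33, upperBlock_diag33_mul, hRt])
    (by rw [lowerBlock_mul_diag33, lowerBlock_diag33_mul, hSu])
  have hPQ : diag33 R S * diag33 R.transpose S.transpose = 1 := by
    rw [diag33_mul, hR.1, hS.1, diag33_one]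
  refine ⟨t, η, R, S, hη, hR, hS, ?_⟩
  rw [Matrix.inv_eq_right_inv hPQ, ← h]
  generalize diag33 R.transpose S.transpose = Q at *
  generalize diag33 R S = P at *
  calc J = (P * Q) * J * (P * Q) := by rw [hPQ, one_mul, mul_one]
    _ = P * (Q * J * P) * Q := by simp only [mul_assoc]
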